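/- Let R̂ and F̂ be compatible R-matrices with F̂ closed, A a unital associative k-algebra, and M an arbitrary N×N matrix over A. For polynomials Y^{(k)} in R̂₁,…,R̂_{k−1} and Z^{(i)} in R̂₁,…,R̂_{i−1}, set α(Y^{(k)}) := Tr_F(1,…,k)(Y^{(k)} M_{1̄} ⋯ M_{k̄}), β(Z^{(i)}) := Tr_F(1,…,i)(Z^{(i)} M_{1̄} ⋯ M_{ī}), and Z^{(k+1,i)} := Z^{(i)}(R̂_{k+1},…,R̂_{k+i−1}). Then α(Y^{(k)}) · β(Z^{(i)}) = Tr_F(1,…,k+i)(Y^{(k)} Z^{(k+1,i)} M_{1̄} M_{2̄} ⋯ M_{(k+i)‾}) in A. -/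

import Mathlib

/-! Common definitions for quantum matrix algebras `M(R̂,F̂)` in the sense of
Isaev–Ogievetsky–Pyatov, "On quantum matrix algebras satisfying the
Cayley-Hamilton-Newton identities".

We model operators on `V^{⊗m}` (where `dim V = N`) as matrices indexed by
multi-indices `Fin m → Fin N`; entries are taken in a (possibly
noncommutative) unital associative algebra `A` over a field `K`.
Sites (tensor factors) are numbered starting from `0`, so the paper's
`X_i` is `site m (i-1) X`, and the paper's `M_{\overline{k}}` is
`Mbar m F F⁻¹ M (k-1)`. -/

namespace CHN

noncomputable section

/-- Operators on `V^{⊗m}` (`dim V = N`) with entries in a ring `A`. -/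
abbrev Op (N : ℕ) (A : Type*) [Ring A] (m : ℕ) :=
  Matrix (Fin m → Fin N) (Fin m → Fin N) A

/-- Operators on `V ⊗ V`. -/
abbrev M2 (N : ℕ) (A : Type*) [Ring A] :=
  Matrix (Fin N × Fin N) (Fin N × Fin N) A

/-- `site m i X` places the two-site operator `X` at the (0-based) tensor
factors `i, i+1` of `V^{⊗m}`, acting as the identity elsewhere.  In the
paper's 1-based notation, `X_i = site m (i-1) X`.  (Out of range it is the
identity.) -/
def site {A : Type*} [Ring A] {N : ℕ} (m i : ℕ) (X : M2 N A) : Op N A m :=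
  fun a b =>
    if h : i + 1 < m then
      X (a ⟨i, Nat.lt_of_succ_lt h⟩, a ⟨i + 1, h⟩)
          (b ⟨i, Nat.lt_of_succ_lt h⟩, b ⟨i + 1, h⟩) *
        (if ∀ j : Fin m, (j : ℕ) ≠ i → (j : ℕ) ≠ i + 1 → a j = b j then 1 else 0)
    else if a = b then 1 else 0

/-- `site1 m i X` places the one-site operator `X` at the (0-based) factor `i`. -/
def site1 {A : Type*} [Ring A] {N : ℕ} (m i : ℕ) (X : Matrix (Fin N) (Fin N) A) :
    Op N A m :=
  fun a b =>
    if h : i < m then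
      X (a ⟨i, h⟩) (b ⟨i, h⟩) *
        (if ∀ j : Fin m, (j : ℕ) ≠ i → a j = b j then 1 else 0)
    else if a = b then 1 else 0

/-- `chain m X i l = X_i X_{i+1} ⋯ X_{i+l-1}` (0-based sites, `l` factors); in
the paper's 1-based notation this is `X_{i+1 → i+l}`. -/
def chain {A : Type*} [Ring A] {N : ℕ} (m : ℕ) (X : M2 N A) (i : ℕ) :
    ℕ → Op N A m
  | 0 => 1
  | l + 1 => chain m X i l * site m (i + l) X

/-- The Yang–Baxter equation `X₁X₂X₁ = X₂X₁X₂` on `V^{⊗3}`. -/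
def YB {A : Type*} [Ring A] {N : ℕ} (X : M2 N A) : Prop :=
  site 3 0 X * site 3 1 X * site 3 0 X = site 3 1 X * site 3 0 X * site 3 1 X

/-- Compatibility of a pair of R-matrices: both Yang–Baxter equations together
with the conditions `R̂₁F̂₂F̂₁ = F̂₂F̂₁R̂₂` and `F̂₁F̂₂R̂₁ = R̂₂F̂₁F̂₂` on `V^{⊗3}`. -/
def Compatible {A : Type*} [Ring A] {N : ℕ} (R F : M2 N A) : Prop :=
  YB R ∧ YB F ∧
    site 3 0 R * site 3 1 F * site 3 0 F = site 3 1 F * site 3 0 F * site 3 1 R ∧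
    site 3 0 F * site 3 1 F * site 3 0 R = site 3 1 R * site 3 0 F * site 3 1 F

/-- `Ψ` witnesses closedness of `F̂`:  `Ψ^{af}_{cg} F̂^{gb}_{fd} = δ^a_d δ^b_c`. -/
def IsClosedPair {A : Type*} [Ring A] {N : ℕ} (F Ψ : M2 N A) : Prop :=
  ∀ a b c d : Fin N,
    (∑ f : Fin N, ∑ g : Fin N, Ψ (a, f) (c, g) * F (g, b) (f, d)) =
      if a = d ∧ b = c then 1 else 0

/-- The matrix `D`, `D^a_b := Ψ^{ac}_{bc}`. -/
def Dmat {A : Type*} [Ring A] {N : ℕ} (Ψ : M2 N A) : Matrix (Fin N) (Fin N) A :=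
  fun a b => ∑ c : Fin N, Ψ (a, c) (b, c)

/-- Quantum trace (with weight `D`) over the last tensor factor. -/
def qtr1 {K : Type*} [Field K] {A : Type*} [Ring A] [Algebra K A] {N m : ℕ}
    (D : Matrix (Fin N) (Fin N) K) (X : Op N A (m + 1)) : Op N A m :=
  fun a b => ∑ c : Fin N, ∑ e : Fin N,
    algebraMap K A (D c e) * X (Fin.snoc a e) (Fin.snoc b c)

/-- Quantum trace over the last `j` tensor factors. -/
def qtrs {K : Type*} [Field K] {A : Type*} [Ring A] [Algebra K A] {N : ℕ}
    (D : Matrix (Fin N) (Fin N) K) (m : ℕ) :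
    (j : ℕ) → Op N A (m + j) → Op N A m
  | 0, X => X
  | j + 1, X => qtrs D m j (qtr1 D X)

/-- Full quantum trace `Tr_F(1,…,m)`, with values in `A`. -/
def qtrAll {K : Type*} [Field K] {A : Type*} [Ring A] [Algebra K A] {N m : ℕ}
    (D : Matrix (Fin N) (Fin N) K) (X : Op N A m) : A :=
  ∑ a : Fin m → Fin N, ∑ b : Fin m → Fin N,
    algebraMap K A (∏ i, D (a i) (b i)) * X b a

/-- Quantum trace of a one-site operator:  `Tr_F X = Tr (D X)`. -/
def trF {K : Type*} [Field K] {A : Type*} [Ring A] [Algebra K A] {N : ℕ}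
    (D : Matrix (Fin N) (Fin N) K) (X : Matrix (Fin N) (Fin N) A) : A :=
  ∑ a : Fin N, ∑ b : Fin N, algebraMap K A (D a b) * X b a

/-- Ordinary partial trace over the last tensor factor. -/
def ptr1 {A : Type*} [Ring A] {N m : ℕ} (X : Op N A (m + 1)) : Op N A m :=
  fun a b => ∑ c : Fin N, X (Fin.snoc a c) (Fin.snoc b c)

/-- Ordinary partial trace over the last `j` tensor factors. -/
def ptrs {A : Type*} [Ring A] {N : ℕ} (m : ℕ) :
    (j : ℕ) → Op N A (m + j) → Op N A m
  | 0, X => X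
  | j + 1, X => ptrs m j (ptr1 X)

/-- `Mbar m F Finv M k` is the paper's `M_{\overline{k+1}}` (0-based index `k`):
`M_{\overline{1}} := M₁` and `M_{\overline{k+1}} := F̂_k M_{\overline{k}} F̂_k⁻¹`. -/
def Mbar {A : Type*} [Ring A] {N : ℕ} (m : ℕ) (F Finv : M2 N A)
    (M : Matrix (Fin N) (Fin N) A) : ℕ → Op N A m
  | 0 => site1 m 0 M
  | k + 1 => site m k F * Mbar m F Finv M k * site m k Finv

/-- `MbarSeg m F Finv M i l = M_{\overline{i+1}} M_{\overline{i+2}} ⋯ M_{\overline{i+l}}`,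
the ordered product of `l` consecutive copies starting at 0-based index `i`.
In particular `MbarSeg m F Finv M 0 k = M_{\overline{1}} ⋯ M_{\overline{k}}`. -/
def MbarSeg {A : Type*} [Ring A] {N : ℕ} (m : ℕ) (F Finv : M2 N A)
    (M : Matrix (Fin N) (Fin N) A) (i : ℕ) : ℕ → Op N A m
  | 0 => 1
  | l + 1 => MbarSeg m F Finv M i l * Mbar m F Finv M (i + l)

/-- The double twist `R̂^{FF} = F̂ (F̂ R̂ F̂⁻¹) F̂⁻¹`. -/
def RFF {K : Type*} [Field K] {N : ℕ} (R F : M2 N K) : M2 N K :=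
  F * (F * R * F⁻¹) * F⁻¹

/-- `M` is a matrix of generators of the algebra `M(R̂,F̂)`:
`R̂₁ M_{\overline{1}} M_{\overline{2}} = M_{\overline{1}} M_{\overline{2}} (R̂^{FF})₁`
on `V ⊗ V`. -/
def IsGenerators {K : Type*} [Field K] {A : Type*} [Ring A] [Algebra K A] {N : ℕ}
    (R F : M2 N K) (M : Matrix (Fin N) (Fin N) A) : Prop :=
  site 2 0 (R.map (algebraMap K A)) *
      MbarSeg 2 (F.map (algebraMap K A)) ((F⁻¹).map (algebraMap K A)) M 0 2 =
    MbarSeg 2 (F.map (algebraMap K A)) ((F⁻¹).map (algebraMap K A)) M 0 2 *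
      site 2 0 ((RFF R F).map (algebraMap K A))

/-- Evaluation of a noncommutative polynomial `Y` in `v` variables, substituting
for the variable `x_j` the operator `R̂` placed at the (0-based) sites
`p+j, p+j+1` of `V^{⊗m}`.  For `p = 0` this is the paper's
`Y^{(v+1)} = Y^{(v+1)}(R̂₁,…,R̂_v)`, and a general `p` gives `Y^{(p+1,v+1)}`. -/
def evalY {K : Type*} [Field K] {A : Type*} [Ring A] [Algebra K A] {N m v : ℕ}
    (R : M2 N A) (p : ℕ) (Y : FreeAlgebra K (Fin v)) : Op N A m :=
  FreeAlgebra.lift K (fun j : Fin v => site m (p + (j : ℕ)) R) Y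

/-- `Ustack m R k l = R̂_{l → l+k-1} ⋯ R̂_{2 → k+1} R̂_{1 → k}` (1-based labels):
the product of `l` descending chains of length `k`. -/
def Ustack {A : Type*} [Ring A] {N : ℕ} (m : ℕ) (R : M2 N A) (k : ℕ) :
    ℕ → Op N A m
  | 0 => 1
  | l + 1 => chain m R l k * Ustack m R k l

/-- The `q`-number `n_q = (qⁿ − q⁻ⁿ)/(q − q⁻¹)`. -/
def qInt {K : Type*} [Field K] (q : K) (n : ℕ) : K :=
  (q ^ n - q⁻¹ ^ n) / (q - q⁻¹)

/-- `R̂` is a Hecke R-matrix for the parameter `q`:  it is invertible, satisfies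
the Yang–Baxter equation and the Hecke condition `R̂² = 1 + (q − q⁻¹)R̂`. -/
def IsHecke {K : Type*} [Field K] {N : ℕ} (q : K) (R : M2 N K) : Prop :=
  IsUnit R ∧ YB R ∧ R * R = 1 + (q - q⁻¹) • R

/-- The `q`-antisymmetrizer `A^{(k)}` built from `R̂`, placed at the (0-based)
tensor factors `p, p+1, …, p+k-1` of `V^{⊗m}`. -/
def qasym {K : Type*} [Field K] {N : ℕ} (q : K) (R : M2 N K) (m p : ℕ) :
    ℕ → Op N K m
  | 0 => 1
  | 1 => 1
  | k + 2 =>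
      (qInt q (k + 2))⁻¹ •
        (qasym q R m p (k + 1) *
          (q ^ (k + 1) • (1 : Op N K m) - qInt q (k + 1) • site m (p + k) R) *
          qasym q R m p (k + 1))

/-- The `q`-symmetrizer `S^{(k)}` built from `R̂`, placed at the (0-based)
tensor factors `p, p+1, …, p+k-1` of `V^{⊗m}`. -/
def qsym {K : Type*} [Field K] {N : ℕ} (q : K) (R : M2 N K) (m p : ℕ) :
    ℕ → Op N K m
  | 0 => 1
  | 1 => 1
  | k + 2 =>
      (qInt q (k + 2))⁻¹ •
        (qsym q R m p (k + 1) *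
          (q⁻¹ ^ (k + 1) • (1 : Op N K m) + qInt q (k + 1) • site m (p + k) R) *
          qsym q R m p (k + 1))

/-- The elementary symmetric function
`σ_k(M) = Tr_F(1,…,k)(A^{(k)} M_{\overline{1}}⋯M_{\overline{k}})` (with `σ_0 = 1`). -/
def sigmaF {K : Type*} [Field K] {A : Type*} [Ring A] [Algebra K A] {N : ℕ}
    (q : K) (R F Ψ : M2 N K) (M : Matrix (Fin N) (Fin N) A) (k : ℕ) : A :=
  qtrAll (Dmat Ψ)
    ((qasym q R k 0 k).map (algebraMap K A) *
      MbarSeg k (F.map (algebraMap K A)) ((F⁻¹).map (algebraMap K A)) M 0 k)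

/-- The complete symmetric function
`τ_k(M) = Tr_F(1,…,k)(S^{(k)} M_{\overline{1}}⋯M_{\overline{k}})` (with `τ_0 = 1`). -/
def tauF {K : Type*} [Field K] {A : Type*} [Ring A] [Algebra K A] {N : ℕ}
    (q : K) (R F Ψ : M2 N K) (M : Matrix (Fin N) (Fin N) A) (k : ℕ) : A :=
  qtrAll (Dmat Ψ)
    ((qsym q R k 0 k).map (algebraMap K A) *
      MbarSeg k (F.map (algebraMap K A)) ((F⁻¹).map (algebraMap K A)) M 0 k)

/-- The power sums `s_k(M) = Tr_F(1,…,k)(R̂_{1→k−1} M_{\overline{1}}⋯M_{\overline{k}})`,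
with `s_0 = 1`. -/
def sF {K : Type*} [Field K] {A : Type*} [Ring A] [Algebra K A] {N : ℕ}
    (R F Ψ : M2 N K) (M : Matrix (Fin N) (Fin N) A) : ℕ → A
  | 0 => 1
  | j + 1 =>
      qtrAll (Dmat Ψ)
        (chain (j + 1) (R.map (algebraMap K A)) 0 j *
          MbarSeg (j + 1) (F.map (algebraMap K A)) ((F⁻¹).map (algebraMap K A)) M 0 (j + 1))

/-- The `(j+1)`-st quantum power of `M`,
`M^{\overline{j+1}} = Tr_F(2,…,j+1)(R̂_{1→j} M_{\overline{1}}⋯M_{\overline{j+1}})`,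
as a one-site operator (so `MpowF R F Ψ M 0 = M₁ = M`). -/
def MpowF {K : Type*} [Field K] {A : Type*} [Ring A] [Algebra K A] {N : ℕ}
    (R F Ψ : M2 N K) (M : Matrix (Fin N) (Fin N) A) (j : ℕ) : Op N A 1 :=
  qtrs (Dmat Ψ) 1 j
    (chain (1 + j) (R.map (algebraMap K A)) 0 j *
      MbarSeg (1 + j) (F.map (algebraMap K A)) ((F⁻¹).map (algebraMap K A)) M 0 (j + 1))

/-- The `(j+1)`-st wedge power of `M`,
`M^{∧(j+1)} = Tr_F(2,…,j+1)(A^{(j+1)} M_{\overline{1}}⋯M_{\overline{j+1}})`. -/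
def MwedgeF {K : Type*} [Field K] {A : Type*} [Ring A] [Algebra K A] {N : ℕ}
    (q : K) (R F Ψ : M2 N K) (M : Matrix (Fin N) (Fin N) A) (j : ℕ) : Op N A 1 :=
  qtrs (Dmat Ψ) 1 j
    ((qasym q R (1 + j) 0 (j + 1)).map (algebraMap K A) *
      MbarSeg (1 + j) (F.map (algebraMap K A)) ((F⁻¹).map (algebraMap K A)) M 0 (j + 1))

/-- The `(j+1)`-st symmetric power of `M`,
`M^{S(j+1)} = Tr_F(2,…,j+1)(S^{(j+1)} M_{\overline{1}}⋯M_{\overline{j+1}})`. -/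
def MsymF {K : Type*} [Field K] {A : Type*} [Ring A] [Algebra K A] {N : ℕ}
    (q : K) (R F Ψ : M2 N K) (M : Matrix (Fin N) (Fin N) A) (j : ℕ) : Op N A 1 :=
  qtrs (Dmat Ψ) 1 j
    ((qsym q R (1 + j) 0 (j + 1)).map (algebraMap K A) *
      MbarSeg (1 + j) (F.map (algebraMap K A)) ((F⁻¹).map (algebraMap K A)) M 0 (j + 1))

/-- `M^{\overline{0}} := q^{-n} n_q Tr_{(2,…,n)}(A^{(n)}) D^{-1}`, with `n = n0 + 1`
(an ordinary, non-quantum, trace over the factors `2,…,n`). -/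
def MzeroF {K : Type*} [Field K] {N : ℕ} (q : K) (R Ψ : M2 N K) (n0 : ℕ) :
    Op N K 1 :=
  (q⁻¹ ^ (n0 + 1) * qInt q (n0 + 1)) •
    (ptrs 1 n0 (qasym q R (1 + n0) 0 (n0 + 1)) * site1 1 0 ((Dmat Ψ)⁻¹))

/-- The generators of the characteristic subalgebra: all elements
`α(Y^{(k)}) = Tr_F(1,…,k)(Y^{(k)} M_{\overline{1}}⋯M_{\overline{k}})`, `k ≥ 1`. -/
def charSet {K : Type*} [Field K] {A : Type*} [Ring A] [Algebra K A] {N : ℕ}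
    (R F Ψ : M2 N K) (M : Matrix (Fin N) (Fin N) A) : Set A :=
  { x : A | ∃ (v : ℕ) (Y : FreeAlgebra K (Fin v)),
      x = qtrAll (Dmat Ψ)
        (evalY (R.map (algebraMap K A)) 0 Y *
          MbarSeg (v + 1) (F.map (algebraMap K A)) ((F⁻¹).map (algebraMap K A)) M 0 (v + 1)) }

end

noncomputable section

section Embedding

variable {A : Type*} [Ring A] {N n m l : ℕ}

/-- The operator on `V^{⊗m}` acting as `X` on the tensor factors `f 0, f 1, …` and as the
identity elsewhere. -/
def embed (f : Fin n → Fin m) (X : Op N A n) : Op N A m :=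
  fun a b => X (a ∘ f) (b ∘ f) * if ∀ j, (∀ i, f i ≠ j) → a j = b j then 1 else 0

/-- The inclusion of `n` consecutive tensor factors into `m`, starting at the factor `i`. -/
def shift (i : ℕ) (h : n + i ≤ m) (t : Fin n) : Fin m := ⟨t + i, by omega⟩

lemma shift_injective (i : ℕ) (h : n + i ≤ m) : Function.Injective (shift i h) := by
  intro s t hst
  simp only [shift, Fin.mk.injEq] at hst
  exact Fin.ext (by omega)

lemma extend_comp_of_disjoint {f : Fin n → Fin m} {g : Fin l → Fin m}
    (hfg : ∀ i j, f i ≠ g j) (d : Fin n → Fin N) (a : Fin m → Fin N) :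
    Function.extend f d a ∘ g = a ∘ g := by
  funext j
  exact Function.extend_apply' _ _ _ fun ⟨i, hi⟩ => hfg i j hi

lemma extend_eq_of_agree {f : Fin n → Fin m} (hf : Function.Injective f) {a b : Fin m → Fin N}
    (h : ∀ j, (∀ i, f i ≠ j) → a j = b j) : Function.extend f (b ∘ f) a = b := by
  funext j
  by_cases hj : ∃ i, f i = j
  · obtain ⟨i, rfl⟩ := hj
    simp [hf.extend_apply]
  · rw [Function.extend_apply' _ _ _ hj]
    exact h j fun i hi => hj ⟨i, hi⟩

lemma extend_agree {f : Fin n → Fin m} (d : Fin n → Fin N) (a : Fin m → Fin N) :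
    ∀ j, (∀ i, f i ≠ j) → a j = Function.extend f d a j := fun _ hj =>
  (Function.extend_apply' _ _ _ fun ⟨i, hi⟩ => hj i hi).symm

lemma extend_comp_self {f : Fin n → Fin m} (hf : Function.Injective f) (d : Fin n → Fin N)
    (a : Fin m → Fin N) : Function.extend f d a ∘ f = d :=
  funext fun i => hf.extend_apply d a i

lemma extend_injective {f : Fin n → Fin m} (hf : Function.Injective f) (a : Fin m → Fin N) :
    Function.Injective fun d : Fin n → Fin N => Function.extend f d a := fun d d' h => by
  rw [← extend_comp_self hf d a, ← extend_comp_self hf d' a]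
  exact congrArg (· ∘ f) h

lemma embed_mul_apply {f : Fin n → Fin m} (hf : Function.Injective f) (X : Op N A n)
    (Y : Op N A m) (a b : Fin m → Fin N) :
    (embed f X * Y) a b = ∑ d, X (a ∘ f) d * Y (Function.extend f d a) b := by
  rw [Matrix.mul_apply]
  symm
  refine Fintype.sum_of_injective _ (extend_injective hf a) _ _ (fun c hc => ?_) fun d => ?_
  · rw [embed, if_neg, mul_zero, zero_mul]
    exact fun h => hc ⟨_, extend_eq_of_agree hf h⟩
  · rw [embed, if_pos (extend_agree d a), mul_one, extend_comp_self hf]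

lemma mul_embed_apply {f : Fin n → Fin m} (hf : Function.Injective f) (X : Op N A n)
    (Y : Op N A m) (a b : Fin m → Fin N) :
    (Y * embed f X) a b = ∑ d, Y a (Function.extend f d b) * X d (b ∘ f) := by
  rw [Matrix.mul_apply]
  symm
  refine Fintype.sum_of_injective _ (extend_injective hf b) _ _ (fun c hc => ?_) fun d => ?_
  · rw [embed, if_neg, mul_zero, mul_zero]
    exact fun h => hc ⟨_, extend_eq_of_agree hf fun j hj => (h j hj).symm⟩
  · rw [embed, if_pos fun j hj => (extend_agree d b j hj).symm, mul_one, extend_comp_self hf]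

lemma embed_mul {f : Fin n → Fin m} (hf : Function.Injective f) (X Y : Op N A n) :
    embed f (X * Y) = embed f X * embed f Y := by
  ext a b
  rw [embed_mul_apply hf, embed, Matrix.mul_apply, Finset.sum_mul]
  refine Finset.sum_congr rfl fun d _ => ?_
  rw [embed, extend_comp_self hf, mul_assoc]
  congr 3
  refine propext (forall₂_congr fun j hj => ?_)
  rw [extend_agree d a j hj]

lemma embed_diagonal (f : Fin n → Fin m) (w : A) :
    embed (N := N) f (Matrix.diagonal fun _ => w) = Matrix.diagonal fun _ => w := by
  ext a b
  rw [embed, Matrix.diagonal_apply, Matrix.diagonal_apply]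
  by_cases h : a = b
  · simp [h]
  · rw [if_neg h]
    by_cases h' : a ∘ f = b ∘ f
    · rw [if_pos h', if_neg, mul_zero]
      refine fun hj => h (funext fun j => ?_)
      by_cases hi : ∃ i, f i = j
      · obtain ⟨i, rfl⟩ := hi
        exact congrFun h' i
      · exact hj j fun i hij => hi ⟨i, hij⟩
    · rw [if_neg h', zero_mul]

lemma embed_one (f : Fin n → Fin m) : embed f (1 : Op N A n) = 1 :=
  embed_diagonal f 1

lemma embed_add (f : Fin n → Fin m) (X Y : Op N A n) :
    embed f (X + Y) = embed f X + embed f Y := by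
  ext a b
  exact add_mul _ _ _

lemma embed_embed {g : Fin l → Fin n} {f : Fin n → Fin m} (hf : Function.Injective f)
    (X : Op N A l) : embed f (embed g X) = embed (f ∘ g) X := by
  ext a b
  simp only [embed, mul_assoc, Function.comp_assoc]
  congr 1
  rw [ite_zero_mul_ite_zero, mul_one]
  congr 1
  refine propext ⟨fun ⟨h₁, h₂⟩ j hj => ?_, fun h => ⟨fun i hi => ?_, fun j hj => ?_⟩⟩
  · by_cases hi : ∃ i, f i = j
    · obtain ⟨i, rfl⟩ := hi
      exact h₁ i fun t ht => hj t (congrArg f ht)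
    · exact h₂ j fun i hij => hi ⟨i, hij⟩
  · exact h _ fun t ht => hi t (hf ht)
  · exact h j fun t => hj _

lemma embed_commute {f : Fin n → Fin m} {g : Fin l → Fin m} (hf : Function.Injective f)
    (hfg : ∀ i j, f i ≠ g j) {X : Op N A n} {Y : Op N A l}
    (hXY : ∀ a b c d, Commute (X a b) (Y c d)) : Commute (embed f X) (embed g Y) := by
  ext a b
  rw [embed_mul_apply hf, mul_embed_apply hf]
  by_cases h : ∀ j, (∀ i, f i ≠ j) → (∀ i, g i ≠ j) → a j = b j
  · rw [Finset.sum_eq_single (b ∘ f), Finset.sum_eq_single (a ∘ f)]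
    · rw [embed, embed, extend_comp_of_disjoint hfg, extend_comp_of_disjoint hfg, mul_assoc,
        ← mul_assoc, (hXY _ _ _ _).eq, mul_assoc, if_pos, if_pos]
      · simp
      all_goals
        intro j hj
        by_cases hi : ∃ i, f i = j
        · obtain ⟨i, rfl⟩ := hi
          simp [hf.extend_apply]
        · rw [Function.extend_apply' _ _ _ hi]
          exact h j (fun i hij => hi ⟨i, hij⟩) hj
    · intro d _ hd
      rw [embed, if_neg, mul_zero, zero_mul]
      intro hj
      refine hd (funext fun i => ?_)
      have := hj (f i) fun t => (hfg i t).symm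
      rw [hf.extend_apply] at this
      exact this.symm
    · simp
    · intro d _ hd
      rw [embed, if_neg, mul_zero, mul_zero]
      intro hj
      refine hd (funext fun i => ?_)
      have := hj (f i) fun t => (hfg i t).symm
      rwa [hf.extend_apply] at this
    · simp
  · push Not at h
    obtain ⟨j, hjf, hjg, hj⟩ := h
    have hj' : ¬ ∃ i, f i = j := fun ⟨i, hi⟩ => hjf i hi
    rw [Finset.sum_eq_zero, Finset.sum_eq_zero]
    all_goals
      intro d _
      rw [embed, if_neg, mul_zero]
      · simp
      · intro h
        have := h j hjg
        rw [Function.extend_apply' _ _ _ hj'] at this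
        exact hj this

/-- `embed f` as a homomorphism of algebras. -/
def embedHom (K : Type*) [Field K] [Algebra K A] (f : Fin n → Fin m)
    (hf : Function.Injective f) : Op N A n →ₐ[K] Op N A m where
  toFun := embed f
  map_one' := embed_one f
  map_mul' := embed_mul hf
  map_zero' := by ext; simp [embed]
  map_add' := embed_add f
  commutes' c := by
    simp only [Matrix.algebraMap_eq_diagonal]
    exact embed_diagonal f _

lemma embed_shift_snoc (h : n + 0 ≤ n + 1) (X : Op N A n) (a b : Fin n → Fin N) (x y : Fin N) :
    embed (shift 0 h) X (Fin.snoc a x : Fin (n + 1) → Fin N) (Fin.snoc b y) =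
      X a b * if x = y then 1 else 0 := by
  have hs : shift 0 h = Fin.castSucc := rfl
  rw [embed, hs, Fin.snoc_comp_castSucc, Fin.snoc_comp_castSucc]
  congr 2
  refine propext ⟨fun hj => by simpa using hj (Fin.last n) fun i => (Fin.castSucc_lt_last i).ne,
    fun hxy j hj => ?_⟩
  induction j using Fin.lastCases with
  | last => simpa using hxy
  | cast i => exact absurd rfl (hj i)

lemma extend_castSucc_snoc (a d : Fin n → Fin N) (x : Fin N) :
    Function.extend Fin.castSucc d (Fin.snoc a x : Fin (n + 1) → Fin N) = Fin.snoc d x := by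
  funext j
  induction j using Fin.lastCases with
  | last =>
    rw [Function.extend_apply' _ _ _ fun ⟨i, hi⟩ => (Fin.castSucc_lt_last i).ne hi]
    simp
  | cast i => simp [(Fin.castSucc_injective n).extend_apply]

lemma embed_mul_apply_snoc (h : n + 0 ≤ n + 1) (X : Op N A n) (Y : Op N A (n + 1))
    (a : Fin n → Fin N) (x : Fin N) (b : Fin (n + 1) → Fin N) :
    (embed (shift 0 h) X * Y) (Fin.snoc a x : Fin (n + 1) → Fin N) b =
      ∑ d, X a d * Y (Fin.snoc d x : Fin (n + 1) → Fin N) b := by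
  have hs : shift 0 h = Fin.castSucc := rfl
  simp only [embed_mul_apply (shift_injective 0 h)]
  simp only [hs, Fin.snoc_comp_castSucc, extend_castSucc_snoc]

lemma mul_embed_apply_snoc (h : n + 0 ≤ n + 1) (X : Op N A n) (Y : Op N A (n + 1))
    (a : Fin n → Fin N) (x : Fin N) (b : Fin (n + 1) → Fin N) :
    (Y * embed (shift 0 h) X) b (Fin.snoc a x : Fin (n + 1) → Fin N) =
      ∑ d, Y b (Fin.snoc d x : Fin (n + 1) → Fin N) * X d a := by
  have hs : shift 0 h = Fin.castSucc := rfl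
  simp only [mul_embed_apply (shift_injective 0 h)]
  simp only [hs, Fin.snoc_comp_castSucc, extend_castSucc_snoc]

lemma sum_snoc {B : Type*} [AddCommMonoid B] (g : (Fin (n + 1) → Fin N) → B) :
    ∑ a, g a = ∑ a : Fin n → Fin N, ∑ x : Fin N, g (Fin.snoc a x) := by
  rw [Finset.sum_comm, ← Fintype.sum_prod_type',
    ← (Fin.snocEquiv fun _ : Fin (n + 1) => Fin N).sum_comp]
  rfl

end Embedding

section Sites

variable {A : Type*} [Ring A] {N n m : ℕ}

/-- A two-site operator viewed as an operator on `V^{⊗2}`. -/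
def twoSite (X : M2 N A) : Op N A 2 := fun a b => X (a 0, a 1) (b 0, b 1)

/-- A one-site operator viewed as an operator on `V^{⊗1}`. -/
def oneSite (X : Matrix (Fin N) (Fin N) A) : Op N A 1 := fun a b => X (a 0) (b 0)

lemma twoSite_mul (X Y : M2 N A) : twoSite (X * Y) = twoSite X * twoSite Y := by
  ext a b
  rw [Matrix.mul_apply, ← (finTwoArrowEquiv (Fin N)).symm.sum_comp]
  rfl

lemma twoSite_one : twoSite (1 : M2 N A) = 1 := by
  ext a b
  simp [twoSite, Matrix.one_apply, funext_iff, Fin.forall_fin_two]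

lemma site_eq_embed {i : ℕ} (h : 2 + i ≤ m) (X : M2 N A) :
    site m i X = embed (shift i h) (twoSite X) := by
  ext a b
  rw [site, dif_pos (by omega)]
  simp only [embed, twoSite]
  congr 2
  · simp [shift, add_comm]
  · simp [shift, add_comm]
  · refine propext (forall_congr' fun j => ?_)
    simp only [Fin.forall_fin_two, shift, ne_eq, Fin.ext_iff]
    rw [← and_imp]
    refine imp_congr_left ?_
    simp
    omega

lemma site1_eq_embed {i : ℕ} (h : 1 + i ≤ m) (X : Matrix (Fin N) (Fin N) A) :
    site1 m i X = embed (shift i h) (oneSite X) := by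
  ext a b
  rw [site1, dif_pos (by omega)]
  simp only [embed, oneSite]
  congr 2
  · simp [shift]
  · simp [shift]
  · refine propext (forall_congr' fun j => ?_)
    simp only [shift, ne_eq, Fin.ext_iff]
    refine imp_congr_left ?_
    simp
    omega

lemma shift_comp_shift {l i j : ℕ} (h : n + i ≤ m) (h' : l + j ≤ n) :
    shift i h ∘ shift j h' = shift (j + i) (by omega) := by
  funext t
  simp [shift, add_assoc]

lemma embed_site {i j : ℕ} (h : n + i ≤ m) (hj : j + 1 < n) (X : M2 N A) :
    embed (shift i h) (site n j X) = site m (j + i) X := by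
  rw [site_eq_embed (by omega), embed_embed (shift_injective i h), shift_comp_shift,
    site_eq_embed (by omega)]

lemma embed_site1 {i j : ℕ} (h : n + i ≤ m) (hj : j < n) (X : Matrix (Fin N) (Fin N) A) :
    embed (shift i h) (site1 n j X) = site1 m (j + i) X := by
  rw [site1_eq_embed (by omega), embed_embed (shift_injective i h), shift_comp_shift,
    site1_eq_embed (by omega)]

lemma site_mul {i : ℕ} (h : i + 1 < m) (X Y : M2 N A) :
    site m i (X * Y) = site m i X * site m i Y := by
  have h' : 2 + i ≤ m := by omega
  rw [site_eq_embed h', site_eq_embed h', site_eq_embed h', twoSite_mul,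
    embed_mul (shift_injective i h')]

lemma site_one {i : ℕ} : site m i (1 : M2 N A) = 1 := by
  by_cases h : 2 + i ≤ m
  · rw [site_eq_embed h, twoSite_one, embed_one]
  · ext a b
    rw [site, dif_neg (by omega), Matrix.one_apply]

lemma site_commute_site {i j : ℕ} (hij : i + 1 < j) (hj : j + 1 < m) {X Y : M2 N A}
    (hXY : ∀ a b c d, Commute (X a b) (Y c d)) : Commute (site m i X) (site m j Y) := by
  rw [site_eq_embed (by omega), site_eq_embed (by omega)]
  refine embed_commute (shift_injective _ _) (fun s t hst => ?_) fun _ _ _ _ => hXY _ _ _ _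
  simp only [shift, Fin.mk.injEq] at hst
  omega

lemma site1_commute_site {i j : ℕ} (hij : i < j) (hj : j + 1 < m) {X : Matrix (Fin N) (Fin N) A}
    {Y : M2 N A} (hXY : ∀ a b c d, Commute (X a b) (Y c d)) :
    Commute (site1 m i X) (site m j Y) := by
  rw [site1_eq_embed (by omega), site_eq_embed (by omega)]
  refine embed_commute (shift_injective _ _) (fun s t hst => ?_) fun _ _ _ _ => hXY _ _ _ _
  simp only [shift, Fin.mk.injEq] at hst
  omega

lemma site_map {B : Type*} [Ring B] (φ : A →+* B) (i : ℕ) (X : M2 N A) :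
    site m i (X.map φ) = (site m i X).map φ := by
  ext a b
  simp only [site, Matrix.map_apply]
  split_ifs <;> simp

lemma extend_shift_snoc (h : 2 + n ≤ n + 1 + 1) (a : Fin n → Fin N) (x y : Fin N)
    (d : Fin 2 → Fin N) :
    Function.extend (shift n h) d
        (Fin.snoc (Fin.snoc a x : Fin (n + 1) → Fin N) y : Fin (n + 1 + 1) → Fin N) =
      Fin.snoc (Fin.snoc a (d 0) : Fin (n + 1) → Fin N) (d 1) := by
  funext j
  induction j using Fin.lastCases with
  | last =>
    have : Fin.last (n + 1) = shift n h 1 := Fin.ext (by simp [shift, add_comm])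
    rw [Fin.snoc_last, this, (shift_injective n h).extend_apply]
  | cast j =>
    rw [Fin.snoc_castSucc]
    induction j using Fin.lastCases with
    | last =>
      have : (Fin.last n).castSucc = shift n h 0 := Fin.ext (by simp [shift])
      rw [Fin.snoc_last, this, (shift_injective n h).extend_apply]
    | cast j =>
      have hj : ¬ ∃ i, shift n h i = j.castSucc.castSucc := fun ⟨i, hi⟩ => by
        have := congrArg Fin.val hi
        simp only [shift, Fin.val_castSucc] at this
        omega
      rw [Function.extend_apply' _ _ _ hj]
      simp

lemma snoc_snoc_comp_shift (h : 2 + n ≤ n + 1 + 1) (a : Fin n → Fin N) (x y : Fin N) :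
    (Fin.snoc (Fin.snoc a x : Fin (n + 1) → Fin N) y : Fin (n + 1 + 1) → Fin N) ∘ shift n h =
      ![x, y] := by
  rw [← extend_comp_self (shift_injective n h) ![x, y]
    (Fin.snoc (Fin.snoc a x : Fin (n + 1) → Fin N) y : Fin (n + 1 + 1) → Fin N),
    extend_shift_snoc]
  rfl

lemma site_mul_apply_snoc (X : M2 N A) (Y : Op N A (n + 1 + 1)) (a : Fin n → Fin N)
    (x y : Fin N) (b : Fin (n + 1 + 1) → Fin N) :
    (site (n + 1 + 1) n X * Y) (Fin.snoc (Fin.snoc a x : Fin (n + 1) → Fin N) y) b =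
      ∑ p, ∑ q, X (x, y) (p, q) * Y (Fin.snoc (Fin.snoc a p : Fin (n + 1) → Fin N) q) b := by
  rw [site_eq_embed (by omega), embed_mul_apply (shift_injective _ _), snoc_snoc_comp_shift,
    ← Fintype.sum_prod_type', ← (finTwoArrowEquiv (Fin N)).sum_comp]
  simp only [extend_shift_snoc]
  rfl

lemma mul_site_apply_snoc (X : M2 N A) (Y : Op N A (n + 1 + 1)) (a : Fin n → Fin N)
    (x y : Fin N) (b : Fin (n + 1 + 1) → Fin N) :
    (Y * site (n + 1 + 1) n X) b (Fin.snoc (Fin.snoc a x : Fin (n + 1) → Fin N) y) =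
      ∑ p, ∑ q, Y b (Fin.snoc (Fin.snoc a p : Fin (n + 1) → Fin N) q) * X (p, q) (x, y) := by
  rw [site_eq_embed (by omega), mul_embed_apply (shift_injective _ _), snoc_snoc_comp_shift,
    ← Fintype.sum_prod_type', ← (finTwoArrowEquiv (Fin N)).sum_comp]
  simp only [extend_shift_snoc]
  rfl

end Sites

section QuantumTrace

variable {K : Type*} [Field K] {A : Type*} [Ring A] [Algebra K A] {N n m : ℕ}
  (D : Matrix (Fin N) (Fin N) K)

lemma qtr1_embed_mul (h : n + 0 ≤ n + 1) (P : Op N A n) (X : Op N A (n + 1)) :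
    qtr1 D (embed (shift 0 h) P * X) = P * qtr1 D X := by
  ext a b
  simp only [qtr1, Matrix.mul_apply (M := P), embed_mul_apply_snoc, Finset.mul_sum]
  rw [Finset.sum_comm_cycle]
  refine Finset.sum_congr rfl fun d _ => Finset.sum_congr rfl fun c _ =>
    Finset.sum_congr rfl fun e _ => ?_
  rw [← mul_assoc, ← mul_assoc, Algebra.commutes]

lemma qtr1_mul_embed (h : n + 0 ≤ n + 1) (P : Op N A n) (X : Op N A (n + 1)) :
    qtr1 D (X * embed (shift 0 h) P) = qtr1 D X * P := by
  ext a b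
  simp only [qtr1, Matrix.mul_apply (N := P), mul_embed_apply_snoc, Finset.mul_sum, Finset.sum_mul]
  rw [Finset.sum_comm_cycle]
  refine Finset.sum_congr rfl fun d _ => Finset.sum_congr rfl fun c _ =>
    Finset.sum_congr rfl fun e _ => ?_
  rw [← mul_assoc]

lemma qtrs_embed_mul (j : ℕ) (h : m + 0 ≤ m + j) (P : Op N A m) (X : Op N A (m + j)) :
    qtrs D m j (embed (shift 0 h) P * X) = P * qtrs D m j X := by
  induction j with
  | zero =>
    have : embed (shift 0 h) P = P := by
      ext a b
      have hs : shift 0 h = id := rfl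
      simp only [embed, hs, Function.comp_id]
      rw [if_pos fun j hj => absurd rfl (hj j), mul_one]
    rw [this]
    rfl
  | succ j ih =>
    have : embed (shift 0 h) P =
        embed (shift (n := m + j) 0 (by omega)) (embed (shift (n := m) 0 (by omega)) P) := by
      rw [embed_embed (shift_injective _ _), shift_comp_shift]
    rw [qtrs, this, qtr1_embed_mul, ih, qtrs]

lemma qtrAll_qtr1 (X : Op N A (m + 1)) : qtrAll D (qtr1 D X) = qtrAll D X := by
  simp only [qtrAll, qtr1, sum_snoc (n := m), Finset.mul_sum]
  refine Finset.sum_congr rfl fun a _ => ?_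
  rw [Finset.sum_comm]
  refine Finset.sum_congr rfl fun c _ => Finset.sum_congr rfl fun b _ =>
    Finset.sum_congr rfl fun e _ => ?_
  simp only [Fin.prod_univ_castSucc, Fin.snoc_castSucc, Fin.snoc_last, map_mul, mul_assoc]

lemma qtrAll_qtrs (j : ℕ) (X : Op N A (m + j)) : qtrAll D (qtrs D m j X) = qtrAll D X := by
  induction j with
  | zero => rfl
  | succ j ih => rw [qtrs, ih, qtrAll_qtr1]

lemma qtrAll_mul_diagonal (X : Op N A m) (w : A) :
    qtrAll D (X * Matrix.diagonal fun _ => w) = qtrAll D X * w := by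
  simp only [qtrAll, Matrix.mul_diagonal, Finset.sum_mul, mul_assoc]

/-- The entries of the operator `X ↦ Tr_F(2)(F̂₁ X₁ F̂₁⁻¹)`. -/
def conjTrace (F G : M2 N K) (x p p' y : Fin N) : K :=
  ∑ c, ∑ e, ∑ q, D c e * F (x, e) (p, q) * G (p', q) (y, c)

lemma qtr1_conj_apply (F G : M2 N K) (h : n + 1 + 0 ≤ n + 1 + 1) (X : Op N A (n + 1))
    (a b : Fin n → Fin N) (x y : Fin N) :
    qtr1 D (site (n + 1 + 1) n (F.map (algebraMap K A)) * embed (shift 0 h) X *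
        site (n + 1 + 1) n (G.map (algebraMap K A))) (Fin.snoc a x) (Fin.snoc b y) =
      ∑ p, ∑ p', algebraMap K A (conjTrace D F G x p p' y) * X (Fin.snoc a p) (Fin.snoc b p') := by
  simp only [qtr1, mul_site_apply_snoc, site_mul_apply_snoc, embed_shift_snoc, mul_ite, mul_one,
    mul_zero, Finset.sum_ite_eq', Finset.mem_univ, if_true]
  simp only [conjTrace, map_sum, map_mul, Finset.mul_sum, Finset.sum_mul, Matrix.map_apply]
  have hperm (g : Fin N → Fin N → Fin N → Fin N → Fin N → A) :
      ∑ c, ∑ e, ∑ p', ∑ q, ∑ p, g c e p' q p = ∑ p, ∑ p', ∑ c, ∑ e, ∑ q, g c e p' q p := by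
    calc ∑ c, ∑ e, ∑ p', ∑ q, ∑ p, g c e p' q p
        = ∑ p', ∑ c, ∑ e, ∑ q, ∑ p, g c e p' q p := Finset.sum_comm_cycle
      _ = ∑ p', ∑ c, ∑ e, ∑ p, ∑ q, g c e p' q p :=
          Finset.sum_congr rfl fun _ _ => Finset.sum_congr rfl fun _ _ =>
            Finset.sum_congr rfl fun _ _ => Finset.sum_comm
      _ = ∑ p', ∑ p, ∑ c, ∑ e, ∑ q, g c e p' q p :=
          Finset.sum_congr rfl fun _ _ => Finset.sum_comm_cycle
      _ = _ := Finset.sum_comm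
  rw [hperm]
  simp only [mul_assoc, ← Algebra.commutes (_ : K) (X _ _)]

end QuantumTrace

section Closed

variable {K : Type*} [Field K] {N : ℕ} {F Ψ : M2 N K}

lemma mul_psi_of_isClosedPair (hΨ : IsClosedPair F Ψ) (f g f' g' : Fin N) :
    ∑ d, ∑ b, F (g, b) (f, d) * Ψ (d, f') (b, g') = if f = f' ∧ g = g' then 1 else 0 := by
  let P : M2 N K := fun x y => Ψ (x.1, y.1) (x.2, y.2)
  let Q : M2 N K := fun x y => F (x.2, y.2) (x.1, y.1)
  have hPQ : P * Q = 1 := by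
    ext x y
    rw [Matrix.mul_apply, Fintype.sum_prod_type, Matrix.one_apply]
    simpa [Prod.ext_iff, eq_comm] using hΨ x.1 y.2 x.2 y.1
  have hQP : Q * P = 1 := mul_eq_one_comm.mp hPQ
  have h := congrFun (congrFun hQP (f, g)) (f', g')
  simpa only [Matrix.mul_apply, Fintype.sum_prod_type, Matrix.one_apply, Prod.mk.injEq] using h

/-- `Tr_F(2) F̂₁ = 1`. -/
lemma qtr1_site_self (hΨ : IsClosedPair F Ψ) (n : ℕ) :
    qtr1 (A := K) (Dmat Ψ) (site (n + 1 + 1) n F) = 1 := by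
  ext a b
  rw [← Fin.snoc_init_self a, ← Fin.snoc_init_self b]
  generalize Fin.init a = a', a (Fin.last n) = x, Fin.init b = b', b (Fin.last n) = y
  have h (c e : Fin N) : site (n + 1 + 1) n F (Fin.snoc (Fin.snoc a' x : Fin (n + 1) → Fin N) e)
      (Fin.snoc (Fin.snoc b' y : Fin (n + 1) → Fin N) c) =
      F (x, e) (y, c) * if a' = b' then 1 else 0 := by
    rw [← mul_one (site _ _ _), site_mul_apply_snoc]
    simp [Matrix.one_apply, Fin.snoc_inj, and_assoc, ite_and]
  have hDF : ∑ c, ∑ e, Dmat Ψ c e * F (x, e) (y, c) = if x = y then 1 else 0 :=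
    calc ∑ c, ∑ e, Dmat Ψ c e * F (x, e) (y, c)
        = ∑ t, ∑ c, ∑ e, F (x, e) (y, c) * Ψ (c, t) (e, t) := by
          simp only [Dmat, Finset.sum_mul]
          rw [Finset.sum_comm_cycle]
          simp only [mul_comm]
      _ = _ := by simp [mul_psi_of_isClosedPair hΨ, ite_and]
  simp [qtr1, h, Matrix.one_apply, Fin.snoc_inj, ite_and, hDF]

lemma conjTrace_of_closed (hF : IsUnit F) (hYB : YB F) (hΨ : IsClosedPair F Ψ)
    (x p p' y : Fin N) :
    conjTrace (Dmat Ψ) F F⁻¹ x p p' y = if x = y then Dmat Ψ p' p else 0 := by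
  have hFF : F * F⁻¹ = 1 := Matrix.mul_nonsing_inv _ ((Matrix.isUnit_iff_isUnit_det F).mp hF)
  have hFF' : F⁻¹ * F = 1 := Matrix.nonsing_inv_mul _ ((Matrix.isUnit_iff_isUnit_det F).mp hF)
  have hs : ∀ X : M2 N K, site 3 0 X = embed (shift (n := 2) (m := 3) 0 (by omega)) (site 2 0 X) :=
    fun X => (embed_site (n := 2) (m := 3) (i := 0) (j := 0) _ (by omega) X).symm
  have hconj : site 3 1 F * site 3 0 F * site 3 1 F⁻¹ =
      site 3 0 F⁻¹ * site 3 1 F * site 3 0 F := by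
    have h₀ : site 3 0 F⁻¹ * site 3 0 F = 1 := by
      rw [← site_mul (m := 3) (i := 0) (by omega), hFF', site_one]
    have h₁ : site 3 1 F * site 3 1 F⁻¹ = 1 := by
      rw [← site_mul (m := 3) (i := 1) (by omega), hFF, site_one]
    calc site 3 1 F * site 3 0 F * site 3 1 F⁻¹
        = site 3 0 F⁻¹ * (site 3 0 F * site 3 1 F * site 3 0 F) * site 3 1 F⁻¹ := by
          simp only [← mul_assoc]; rw [h₀, one_mul]
      _ = site 3 0 F⁻¹ * (site 3 1 F * site 3 0 F) * (site 3 1 F * site 3 1 F⁻¹) := by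
          rw [hYB]; simp only [mul_assoc]
      _ = _ := by rw [h₁, mul_one, mul_assoc]
  have htr : qtr1 (A := K) (Dmat Ψ) (site 3 1 F * site 3 0 F * site 3 1 F⁻¹) = 1 := by
    rw [hconj, hs F⁻¹, hs F, qtr1_mul_embed, qtr1_embed_mul, qtr1_site_self hΨ, mul_one,
      ← site_mul Nat.one_lt_two, hFF', site_one]
  have hT (s t : Fin N) : ∑ q, ∑ q', conjTrace (Dmat Ψ) F F⁻¹ x q q' y * F (s, q) (t, q') =
      if s = t ∧ x = y then 1 else 0 := by
    have h := congrFun (congrFun htr (Fin.snoc ![s] x)) (Fin.snoc ![t] y)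
    have h' := qtr1_conj_apply (A := K) (n := 1) (Dmat Ψ) F F⁻¹ (by omega) (site 2 0 F)
      ![s] ![t] x y
    rw [← hs] at h'
    simp only [Algebra.algebraMap_self, RingHom.id_apply, RingHom.coe_id, Matrix.map_id] at h'
    rw [h'] at h
    have h₂ (q q' : Fin N) : site 2 0 F (Fin.snoc ![s] q) (Fin.snoc ![t] q') =
        F (s, q) (t, q') := by
      simp [site, Fin.snoc]
    simp only [h₂] at h
    rw [h, Matrix.one_apply]
    simp
  calc conjTrace (Dmat Ψ) F F⁻¹ x p p' y
      = ∑ q, ∑ q', conjTrace (Dmat Ψ) F F⁻¹ x q q' y *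
          ∑ t, ∑ s, Ψ (p', t) (p, s) * F (s, q) (t, q') := by
        simp only [hΨ p' _ p _]
        simp [ite_and]
    _ = ∑ t, ∑ s, Ψ (p', t) (p, s) *
          ∑ q, ∑ q', conjTrace (Dmat Ψ) F F⁻¹ x q q' y * F (s, q) (t, q') := by
        simp only [Finset.mul_sum]
        rw [Finset.sum_comm_cycle]
        refine Finset.sum_congr rfl fun t _ => ?_
        rw [Finset.sum_comm_cycle]
        simp only [mul_left_comm]
    _ = _ := by
        simp [hT, ite_and, Dmat]

end Closed

section Chains

variable {A : Type*} [Ring A] {N m : ℕ}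

/-- The inverse of `chain m X i l`, where `Y` is the inverse of `X`. -/
def chainInv (m : ℕ) (Y : M2 N A) (i : ℕ) : ℕ → Op N A m
  | 0 => 1
  | l + 1 => site m (i + l) Y * chainInv m Y i l

lemma chain_mul_chainInv {X Y : M2 N A} (h : X * Y = 1) (i l : ℕ) (hl : i + l < m) :
    chain m X i l * chainInv m Y i l = 1 := by
  induction l with
  | zero => simp [chain, chainInv]
  | succ l ih =>
    rw [chain, chainInv, mul_assoc, ← mul_assoc (site _ _ _), ← site_mul (by omega), h, site_one,
      one_mul, ih (by omega)]

lemma embed_chain {n : ℕ} (h : n + 0 ≤ m) (X : M2 N A) (i l : ℕ) (hl : i + l < n) :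
    embed (shift 0 h) (chain n X i l) = chain m X i l := by
  induction l with
  | zero => exact embed_one _
  | succ l ih =>
    rw [chain, chain, embed_mul (shift_injective _ _), ih (by omega), embed_site _ (by omega),
      add_zero]

lemma embed_chainInv {n : ℕ} (h : n + 0 ≤ m) (X : M2 N A) (i l : ℕ) (hl : i + l < n) :
    embed (shift 0 h) (chainInv n X i l) = chainInv m X i l := by
  induction l with
  | zero => exact embed_one _
  | succ l ih =>
    rw [chainInv, chainInv, embed_mul (shift_injective _ _), ih (by omega),
      embed_site _ (by omega), add_zero]

lemma embed_Mbar {n : ℕ} (h : n + 0 ≤ m) (F G : M2 N A) (M : Matrix (Fin N) (Fin N) A) (k : ℕ)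
    (hk : k < n) : embed (shift 0 h) (Mbar n F G M k) = Mbar m F G M k := by
  induction k with
  | zero => exact embed_site1 _ hk M
  | succ k ih =>
    rw [Mbar, Mbar, embed_mul (shift_injective _ _), embed_mul (shift_injective _ _),
      ih (by omega), embed_site _ hk, embed_site _ hk, add_zero]

lemma embed_MbarSeg {n : ℕ} (h : n + 0 ≤ m) (F G : M2 N A) (M : Matrix (Fin N) (Fin N) A)
    (i l : ℕ) (hl : i + l ≤ n) :
    embed (shift 0 h) (MbarSeg n F G M i l) = MbarSeg m F G M i l := by
  induction l with
  | zero => exact embed_one _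
  | succ l ih =>
    rw [MbarSeg, MbarSeg, embed_mul (shift_injective _ _), ih (by omega),
      embed_Mbar _ _ _ _ _ (by omega)]

lemma MbarSeg_add (F G : M2 N A) (M : Matrix (Fin N) (Fin N) A) (i k l : ℕ) :
    MbarSeg m F G M i (k + l) = MbarSeg m F G M i k * MbarSeg m F G M (i + k) l := by
  induction l with
  | zero => simp [MbarSeg]
  | succ l ih => rw [← add_assoc, MbarSeg, ih, MbarSeg, mul_assoc, add_assoc]

lemma embed_evalY {K : Type*} [Field K] [Algebra K A] {n v : ℕ} (h : n + 0 ≤ m) (R : M2 N A)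
    (p : ℕ) (Y : FreeAlgebra K (Fin v)) (hp : p + v < n) :
    embed (shift 0 h) (evalY R p Y) = evalY R p Y := by
  change ((embedHom K _ (shift_injective 0 h)).comp (FreeAlgebra.lift K _)) Y = _
  rw [evalY]
  congr 1
  ext j
  simpa [embedHom] using congrFun (congrFun (embed_site h (by omega) R) _) _

/-- Conjugation by an element intertwining generators intertwines polynomials in them. -/
lemma semiconjBy_evalY {K : Type*} [Field K] [Algebra K A] {v p p' : ℕ} {R : M2 N A} {C : Op N A m}
    (h : ∀ j < v, SemiconjBy C (site m (p + j) R) (site m (p' + j) R))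
    (Y : FreeAlgebra K (Fin v)) : SemiconjBy C (evalY R p Y) (evalY R p' Y) := by
  induction Y using FreeAlgebra.induction with
  | grade0 r =>
    simp only [evalY, AlgHom.commutes]
    exact Algebra.commute_algebraMap_right r C
  | grade1 j => simpa [evalY] using h j j.2
  | mul a b ha hb => simpa [evalY] using ha.mul_right hb
  | add a b ha hb => simpa [evalY] using ha.add_right hb

end Chains

section Compatible

variable {K : Type*} [Field K] {A : Type*} [Ring A] [Algebra K A] {N m : ℕ} {R F Ψ : M2 N K}

lemma map_commute (X Y : M2 N K) (a b c d : Fin N × Fin N) :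
    Commute (X.map (algebraMap K A) a b) (Y.map (algebraMap K A) c d) :=
  Algebra.commute_algebraMap_left _ _

/-- A relation between products of three site operators on `V^{⊗3}` holds at any three
consecutive factors. -/
lemma site_relation {X₁ X₂ X₃ Y₁ Y₂ Y₃ : M2 N K} {i₁ i₂ i₃ j₁ j₂ j₃ : ℕ}
    (hi₁ : i₁ < 2) (hi₂ : i₂ < 2) (hi₃ : i₃ < 2) (hj₁ : j₁ < 2) (hj₂ : j₂ < 2) (hj₃ : j₃ < 2)
    (h : site 3 i₁ X₁ * site 3 i₂ X₂ * site 3 i₃ X₃ = site 3 j₁ Y₁ * site 3 j₂ Y₂ * site 3 j₃ Y₃)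
    {i : ℕ} (hi : i + 2 < m) :
    site m (i₁ + i) (X₁.map (algebraMap K A)) * site m (i₂ + i) (X₂.map (algebraMap K A)) *
        site m (i₃ + i) (X₃.map (algebraMap K A)) =
      site m (j₁ + i) (Y₁.map (algebraMap K A)) * site m (j₂ + i) (Y₂.map (algebraMap K A)) *
        site m (j₃ + i) (Y₃.map (algebraMap K A)) := by
  have h3 : 3 + i ≤ m := by omega
  have hφ := congrArg (fun X : Op N K 3 => embed (shift i h3) (X.map (algebraMap K A))) h
  simpa only [Matrix.map_mul, ← site_map, embed_mul (shift_injective i h3),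
    embed_site h3 (Nat.succ_lt_succ hi₁), embed_site h3 (Nat.succ_lt_succ hi₂),
    embed_site h3 (Nat.succ_lt_succ hi₃), embed_site h3 (Nat.succ_lt_succ hj₁),
    embed_site h3 (Nat.succ_lt_succ hj₂), embed_site h3 (Nat.succ_lt_succ hj₃)] using hφ

lemma Mbar_commute_site (F G X : M2 N K) (M : Matrix (Fin N) (Fin N) A) {t s : ℕ} (hts : t < s)
    (hs : s + 1 < m) :
    Commute (Mbar m (F.map (algebraMap K A)) (G.map (algebraMap K A)) M t)
      (site m s (X.map (algebraMap K A))) := by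
  induction t with
  | zero => exact site1_commute_site hts hs fun _ _ _ _ => Algebra.commute_algebraMap_right _ _
  | succ t ih =>
    exact ((site_commute_site hts hs (map_commute F X)).mul_left (ih (by omega))).mul_left
      (site_commute_site hts hs (map_commute G X))

lemma site_mul_inv {X Y : M2 N K} (h : X * Y = 1) {i : ℕ} (hi : i + 1 < m) :
    site m i (X.map (algebraMap K A)) * site m i (Y.map (algebraMap K A)) = 1 := by
  rw [← site_mul hi, ← Matrix.map_mul, h, Matrix.map_one _ (map_zero _) (map_one _), site_one]

lemma site_commute_Mbar {G : M2 N K} (hYB : YB F) (hFG : F * G = 1) (M : Matrix (Fin N) (Fin N) A)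
    {s t : ℕ} (hst : s + 2 ≤ t) (ht : t < m) :
    Commute (site m s (F.map (algebraMap K A)))
      (Mbar m (F.map (algebraMap K A)) (G.map (algebraMap K A)) M t) := by
  have hGF : G * F = 1 := mul_eq_one_comm.mp hFG
  induction t, hst using Nat.le_induction with
  | base =>
    let a := site m s (F.map (algebraMap K A))
    let b := site m (s + 1) (F.map (algebraMap K A))
    let a' := site m s (G.map (algebraMap K A))
    let b' := site m (s + 1) (G.map (algebraMap K A))
    let x := Mbar m (F.map (algebraMap K A)) (G.map (algebraMap K A)) M s
    have haa' : a * a' = 1 := site_mul_inv hFG (by omega)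
    have hbb' : b * b' = 1 := site_mul_inv hFG (by omega)
    have haa : a' * a = 1 := site_mul_inv hGF (by omega)
    have hbb : b' * b = 1 := site_mul_inv hGF (by omega)
    have hbx : Commute b x := (Mbar_commute_site F G F M (by omega) (by omega)).symm
    have hab : a * b * a = b * a * b := by
      simpa [add_comm] using
        site_relation (A := A) (m := m) (i := s) (by omega) (by omega) (by omega) (by omega)
          (by omega) (by omega) hYB (by omega)
    let g : (Op N A m)ˣ := ⟨b * a, a' * b', by
      rw [mul_assoc, ← mul_assoc a, haa', one_mul, hbb'], by
      rw [mul_assoc, ← mul_assoc b', hbb, one_mul, haa]⟩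
    have hg : SemiconjBy (g : Op N A m) b a := by
      change b * a * b = a * (b * a)
      rw [← hab, mul_assoc]
    have hg' : SemiconjBy ((g⁻¹ : (Op N A m)ˣ) : Op N A m) a b := hg.units_inv_symm_left
    have h₁ : a * (g * x * ((g⁻¹ : (Op N A m)ˣ) : Op N A m)) =
        (g * x * ((g⁻¹ : (Op N A m)ˣ) : Op N A m)) * a := by
      rw [← mul_assoc, ← mul_assoc, ← hg.eq, mul_assoc (g : Op N A m), hbx.eq,
        mul_assoc _ _ a, hg'.eq]
      simp only [mul_assoc]
    have h₂ : Mbar m (F.map (algebraMap K A)) (G.map (algebraMap K A)) M (s + 2) =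
        g * x * ((g⁻¹ : (Op N A m)ˣ) : Op N A m) := by
      change b * (a * x * a') * b' = b * a * x * (a' * b')
      simp only [mul_assoc]
    rw [h₂]
    exact h₁
  | succ t hst ih =>
    exact ((site_commute_site (by omega) ht (map_commute F F)).mul_right (ih (by omega))).mul_right
      (site_commute_site (by omega) ht (map_commute F G))

lemma chain_semiconjBy_Mbar {G : M2 N K} (hYB : YB F) (hFG : F * G = 1)
    (M : Matrix (Fin N) (Fin N) A) {p j l : ℕ} (hj : j < l) (hl : p + l < m) :
    SemiconjBy (chain m (F.map (algebraMap K A)) p l)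
      (Mbar m (F.map (algebraMap K A)) (G.map (algebraMap K A)) M (p + j))
      (Mbar m (F.map (algebraMap K A)) (G.map (algebraMap K A)) M (p + j + 1)) := by
  induction l with
  | zero => omega
  | succ l ih =>
    rcases Nat.lt_succ_iff_lt_or_eq.mp hj with hj | rfl
    · exact (ih hj (by omega)).mul_left
        (Mbar_commute_site F G F M (by omega) (by omega)).symm
    · have hchain (l : ℕ) (hl : l ≤ j) : Commute (chain m (F.map (algebraMap K A)) p l)
          (Mbar m (F.map (algebraMap K A)) (G.map (algebraMap K A)) M (p + j + 1)) := by
        induction l with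
        | zero => exact Commute.one_left _
        | succ l ih =>
          exact (ih (by omega)).mul_left
            (site_commute_Mbar hYB hFG M (by omega) (by omega))
      refine (show SemiconjBy _ _ _ from hchain j le_rfl).mul_left ?_
      rw [SemiconjBy, Mbar, mul_assoc _ _ (site _ _ _),
        site_mul_inv (mul_eq_one_comm.mp hFG) (by omega), mul_one]

lemma chain_semiconjBy_site (h : Compatible R F) {p j l : ℕ} (hj : j + 1 < l) (hl : p + l < m) :
    SemiconjBy (chain m (F.map (algebraMap K A)) p l) (site m (p + j) (R.map (algebraMap K A)))
      (site m (p + j + 1) (R.map (algebraMap K A))) := by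
  induction l with
  | zero => omega
  | succ l ih =>
    rcases Nat.lt_succ_iff_lt_or_eq.mp hj with hj | rfl
    · exact (ih hj (by omega)).mul_left
        (site_commute_site (by omega) (by omega) (map_commute R F)).symm
    · have hchain (l : ℕ) (hl : l ≤ j) : Commute (chain m (F.map (algebraMap K A)) p l)
          (site m (p + j + 1) (R.map (algebraMap K A))) := by
        induction l with
        | zero => exact Commute.one_left _
        | succ l ih =>
          exact (ih (by omega)).mul_left
            (site_commute_site (by omega) (by omega) (map_commute F R))
      rw [chain, chain, mul_assoc]
      refine (show SemiconjBy _ _ _ from hchain j le_rfl).mul_left ?_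
      have := site_relation (A := A) (m := m) (i := p + j) (by omega) (by omega) (by omega)
        (by omega) (by omega) (by omega) h.2.2.2 (by omega)
      rw [zero_add, add_comm 1] at this
      rw [SemiconjBy, ← mul_assoc]
      exact this

lemma qtr1_conj (hF : IsUnit F) (hYB : YB F) (hΨ : IsClosedPair F Ψ) {n n' : ℕ} (hn : n' = n + 1)
    (h : n + 1 + 0 ≤ n' + 1) (h' : n + 0 ≤ n') (X : Op N A (n + 1)) :
    qtr1 (Dmat Ψ) (site (n' + 1) n (F.map (algebraMap K A)) * embed (shift 0 h) X *
        site (n' + 1) n ((F⁻¹).map (algebraMap K A))) =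
      embed (shift 0 h') (qtr1 (Dmat Ψ) X) := by
  subst hn
  ext a b
  rw [← Fin.snoc_init_self a, ← Fin.snoc_init_self b, qtr1_conj_apply, embed_shift_snoc]
  simp only [conjTrace_of_closed hF hYB hΨ, qtr1]
  rw [Finset.sum_comm]
  split_ifs <;> simp

/-- `Tr_F(p+2,…,p+i+1)(F̂_{p+1 → p+i} X F̂_{p+1 → p+i}⁻¹) = Tr_F(p+1,…,p+i)(X)`. -/
lemma qtrs_conj_chain (hF : IsUnit F) (hYB : YB F) (hΨ : IsClosedPair F Ψ) (p i : ℕ)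
    (h : p + i + 0 ≤ p + 1 + i) (h' : p + 0 ≤ p + 1) (X : Op N A (p + i)) :
    qtrs (Dmat Ψ) (p + 1) i (chain (p + 1 + i) (F.map (algebraMap K A)) p i *
        embed (shift 0 h) X * chainInv (p + 1 + i) ((F⁻¹).map (algebraMap K A)) p i) =
      embed (shift 0 h') (qtrs (Dmat Ψ) p i X) := by
  induction i with
  | zero => simp [chain, chainInv, qtrs]
  | succ i ih =>
    have h₁ : p + 1 + i + 0 ≤ p + 1 + i + 1 := by omega
    have h₂ : p + i + 0 ≤ p + 1 + i := by omega
    rw [qtrs, qtrs, ← ih h₂,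
      ← qtr1_conj hF hYB hΨ (n := p + i) (n' := p + 1 + i) (by omega) h h₂,
      ← qtr1_embed_mul (h := h₁), ← qtr1_mul_embed (h := h₁),
      embed_chain _ _ _ _ (by omega), embed_chainInv _ _ _ _ (by omega)]
    simp only [chain, chainInv, mul_assoc]
    rfl

/-- `Tr_F(p+1,…,p+i)(Z^{(p+1,i)} M_{p+1} ⋯ M_{p+i})` is the scalar operator `β(Z^{(i)})`. -/
lemma qtrs_evalY_mul_MbarSeg (hF : IsUnit F) (h : Compatible R F) (hΨ : IsClosedPair F Ψ)
    (M : Matrix (Fin N) (Fin N) A) (v : ℕ) (Z : FreeAlgebra K (Fin v)) (p : ℕ) :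
    qtrs (Dmat Ψ) p (v + 1) (evalY (R.map (algebraMap K A)) p Z *
        MbarSeg (p + (v + 1)) (F.map (algebraMap K A)) ((F⁻¹).map (algebraMap K A)) M p (v + 1)) =
      Matrix.diagonal fun _ => qtrAll (Dmat Ψ) (evalY (R.map (algebraMap K A)) 0 Z *
        MbarSeg (v + 1) (F.map (algebraMap K A)) ((F⁻¹).map (algebraMap K A)) M 0 (v + 1)) := by
  have hYB : YB F := h.2.1
  have hFG : F * F⁻¹ = 1 := Matrix.mul_nonsing_inv _ ((Matrix.isUnit_iff_isUnit_det F).mp hF)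
  induction p with
  | zero =>
    have hm (m : ℕ) (hm : m = v + 1) :
        qtrAll (Dmat Ψ) (evalY (m := m) (R.map (algebraMap K A)) 0 Z *
        MbarSeg m (F.map (algebraMap K A)) ((F⁻¹).map (algebraMap K A)) M 0 (v + 1)) =
        qtrAll (Dmat Ψ) (evalY (m := v + 1) (R.map (algebraMap K A)) 0 Z *
        MbarSeg (v + 1) (F.map (algebraMap K A)) ((F⁻¹).map (algebraMap K A)) M 0 (v + 1)) := by
      subst hm
      rfl
    rw [← hm (0 + (v + 1)) (zero_add _), ← qtrAll_qtrs]
    ext a b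
    obtain rfl : a = b := Subsingleton.elim _ _
    obtain rfl : a = default := Subsingleton.elim _ _
    simp [qtrAll]
  | succ p ih =>
    have h₁ : p + (v + 1) + 0 ≤ p + 1 + (v + 1) := by omega
    have hconj : SemiconjBy (chain (p + 1 + (v + 1)) (F.map (algebraMap K A)) p (v + 1))
        (evalY (R.map (algebraMap K A)) p Z * MbarSeg (p + 1 + (v + 1)) (F.map (algebraMap K A))
          ((F⁻¹).map (algebraMap K A)) M p (v + 1))
        (evalY (R.map (algebraMap K A)) (p + 1) Z * MbarSeg (p + 1 + (v + 1))
          (F.map (algebraMap K A)) ((F⁻¹).map (algebraMap K A)) M (p + 1) (v + 1)) := by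
      refine (semiconjBy_evalY (fun j hj => ?_) Z).mul_right ?_
      · rw [add_right_comm p 1 j]
        exact chain_semiconjBy_site h (by omega) (by omega)
      · have hseg (l : ℕ) (hl : l ≤ v + 1) :
            SemiconjBy (chain (p + 1 + (v + 1)) (F.map (algebraMap K A)) p (v + 1))
              (MbarSeg (p + 1 + (v + 1)) (F.map (algebraMap K A)) ((F⁻¹).map (algebraMap K A)) M
                p l)
              (MbarSeg (p + 1 + (v + 1)) (F.map (algebraMap K A)) ((F⁻¹).map (algebraMap K A)) M
                (p + 1) l) := by
          induction l with
          | zero => exact SemiconjBy.one_right _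
          | succ l ih =>
            refine (ih (by omega)).mul_right ?_
            rw [add_right_comm p 1 l]
            exact chain_semiconjBy_Mbar hYB hFG M (by omega) (by omega)
        exact hseg _ le_rfl
    have hinv : chain (p + 1 + (v + 1)) (F.map (algebraMap K A)) p (v + 1) *
        chainInv (p + 1 + (v + 1)) ((F⁻¹).map (algebraMap K A)) p (v + 1) = 1 :=
      chain_mul_chainInv (by
        rw [← Matrix.map_mul, hFG, Matrix.map_one _ (map_zero _) (map_one _)]) _ _ (by omega)
    rw [← embed_diagonal (shift 0 (Nat.le_succ p)), ← ih, ← qtrs_conj_chain hF hYB hΨ p (v + 1) h₁,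
      embed_mul (shift_injective _ _), embed_evalY _ _ _ _ (by omega),
      embed_MbarSeg _ _ _ _ _ _ le_rfl, hconj.eq, mul_assoc _ _ (chainInv _ _ _ _), hinv, mul_one]

end Compatible

end

/-- (19).  For compatible R-matrices `R̂, F̂` with `F̂` closed and
an arbitrary matrix `M` over `A`:  for polynomials `Y^{(k)}` in `R̂₁,…,R̂_{k−1}`
and `Z^{(i)}` in `R̂₁,…,R̂_{i−1}` (here `k = k0+1`, `i = i0+1`),
`α(Y^{(k)}) β(Z^{(i)}) = Tr_F(1,…,k+i)(Y^{(k)} Z^{(k+1,i)} M_{\overline{1}} ⋯ M_{\overline{k+i}})`,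
where `Z^{(k+1,i)} = Z(R̂_{k+1},…,R̂_{k+i−1})` is evaluated by `evalY _ (k0+1) Z`. -/
theorem alpha_beta_product {K : Type} [Field K] {A : Type} [Ring A] [Algebra K A]
    {N : ℕ} (R F Ψ : M2 N K) (hR : IsUnit R) (hF : IsUnit F)
    (h : Compatible R F) (hΨ : IsClosedPair F Ψ)
    (M : Matrix (Fin N) (Fin N) A) :
    ∀ (k0 i0 : ℕ) (Y : FreeAlgebra K (Fin k0)) (Z : FreeAlgebra K (Fin i0)),
      qtrAll (Dmat Ψ)
          (evalY (R.map (algebraMap K A)) 0 Y *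
            MbarSeg (k0 + 1) (F.map (algebraMap K A))
              ((F⁻¹).map (algebraMap K A)) M 0 (k0 + 1)) *
        qtrAll (Dmat Ψ)
          (evalY (R.map (algebraMap K A)) 0 Z *
            MbarSeg (i0 + 1) (F.map (algebraMap K A))
              ((F⁻¹).map (algebraMap K A)) M 0 (i0 + 1)) =
      qtrAll (Dmat Ψ)
        (evalY (R.map (algebraMap K A)) 0 Y *
          evalY (R.map (algebraMap K A)) (k0 + 1) Z *
          MbarSeg (k0 + 1 + (i0 + 1)) (F.map (algebraMap K A))
            ((F⁻¹).map (algebraMap K A)) M 0 (k0 + 1 + (i0 + 1))) := by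
  intro k0 i0 Y Z
  have hle : k0 + 1 + 0 ≤ k0 + 1 + (i0 + 1) := by omega
  have hcomm : SemiconjBy (MbarSeg (k0 + 1 + (i0 + 1)) (F.map (algebraMap K A))
      ((F⁻¹).map (algebraMap K A)) M 0 (k0 + 1)) (evalY (R.map (algebraMap K A)) (k0 + 1) Z)
      (evalY (R.map (algebraMap K A)) (k0 + 1) Z) := by
    refine semiconjBy_evalY (fun j hj => ?_) Z
    have hseg (l : ℕ) (hl : l ≤ k0 + 1) : Commute (MbarSeg (k0 + 1 + (i0 + 1))
        (F.map (algebraMap K A)) ((F⁻¹).map (algebraMap K A)) M 0 l)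
        (site (k0 + 1 + (i0 + 1)) (k0 + 1 + j) (R.map (algebraMap K A))) := by
      induction l with
      | zero => exact Commute.one_left _
      | succ l ih =>
        exact (ih (by omega)).mul_left (Mbar_commute_site F F⁻¹ R M (by omega) (by omega))
    exact hseg _ le_rfl
  rw [← qtrAll_mul_diagonal, ← qtrs_evalY_mul_MbarSeg hF h hΨ M i0 Z (k0 + 1),
    ← qtrs_embed_mul (h := hle), qtrAll_qtrs, embed_mul (shift_injective _ _),
    embed_evalY _ _ _ _ (by omega), embed_MbarSeg _ _ _ _ _ _ (by omega),
    MbarSeg_add _ _ _ 0 (k0 + 1), zero_add]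
  congr 1
  rw [mul_assoc, ← mul_assoc (MbarSeg _ _ _ _ _ _), hcomm.eq]
  simp only [mul_assoc]

end CHN
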